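/- Let τ be a finite set of unary relation symbols and let φ be any formula of the one-variable Presburger logic P¹ over τ. Then there exists a finite set S of flat P¹ formulas over the same signature τ such that φ has a finite model if and only if some formula ψ ∈ S has a finite model. -/

import Mathlib

/- Syntax of the one-variable Presburger logic `P¹` over a signature `τ` of
unary relation symbols.  Counting terms are sums of expressions `a·#x[φ]` with
`a` a non-zero integer; formulas are built from atoms `P(x)` by negation,
conjunction, threshold constraints `t ≥ b` (`b ∈ ℕ`) and modular constraints
`t ≡_c d` (`c` a positive integer, `d ∈ {0,…,c−1}`). -/
mutual
inductive PTerm (τ : Type) : Type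
  | add : PTerm τ → PTerm τ → PTerm τ
  | count : (a : ℤ) → a ≠ 0 → PFormula τ → PTerm τ

inductive PFormula (τ : Type) : Type
  | atom : τ → PFormula τ
  | not : PFormula τ → PFormula τ
  | and : PFormula τ → PFormula τ → PFormula τ
  | ge : PTerm τ → ℕ → PFormula τ
  | mod : PTerm τ → (c : ℕ) → 0 < c → (d : ℕ) → d < c → PFormula τ
end

/- Semantics of `P¹` in a finite structure with universe `M` and interpretation
`interp`: the value of `#x[φ]` is the number of elements satisfying `φ`, terms
are evaluated in `ℤ`. -/
mutual
def PTerm.val {τ M : Type} [Fintype M] (interp : τ → M → Bool) : PTerm τ → ℤ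
  | .add t₁ t₂ => t₁.val interp + t₂.val interp
  | .count a _ φ => a * ((Finset.univ.filter (fun x => φ.sat interp x = true)).card : ℤ)

def PFormula.sat {τ M : Type} [Fintype M] (interp : τ → M → Bool) : PFormula τ → M → Bool
  | .atom P, x => interp P x
  | .not φ, x => !(φ.sat interp x)
  | .and φ ψ, x => φ.sat interp x && ψ.sat interp x
  | .ge t b, _ => decide ((b : ℤ) ≤ t.val interp)
  | .mod t c _ d _, _ => decide (t.val interp % (c : ℤ) = (d : ℤ))
end

/-- A `P¹` formula has a finite model if it holds in some finite nonempty
`τ`-structure. -/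
def PFinSat {τ : Type} (φ : PFormula τ) : Prop :=
  ∃ (M : Type) (instM : Fintype M), Nonempty M ∧
    ∃ (interp : τ → M → Bool) (a : M), @PFormula.sat τ M instM interp φ a = true

/-- One-variable formulas over `τ` that are free of counting terms:
atoms `P(x)` combined with negation and conjunction. -/
inductive QF (τ : Type) : Type
  | atom : τ → QF τ
  | not : QF τ → QF τ
  | and : QF τ → QF τ → QF τ

/-- Satisfaction of a counting-term-free formula at an element of a structure. -/
def QF.sat {τ M : Type} (interp : τ → M → Bool) : QF τ → M → Bool
  | .atom P, a => interp P a
  | .not φ, a => !(φ.sat interp a)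
  | .and φ ψ, a => φ.sat interp a && ψ.sat interp a

/-- The comparison symbols `⋈` allowed in a flat `P¹` formula:
`≤`, `≥`, or congruence modulo a positive integer `k`. -/
inductive Cmp : Type
  | le : Cmp
  | ge : Cmp
  | mod : (k : ℕ) → 0 < k → Cmp

/-- `Cmp.holds c v b` expresses that the integer `v` stands in relation `c` to
the natural number `b`: `v ≤ b`, `v ≥ b`, or `v ≡ b (mod k)`. -/
def Cmp.holds : Cmp → ℤ → ℕ → Prop
  | .le, v, b => v ≤ (b : ℤ)
  | .ge, v, b => (b : ℤ) ≤ v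
  | .mod k _, v, b => v % (k : ℤ) = (b : ℤ) % (k : ℤ)

/-- One conjunct `(Σ_j a_j·#x[φ_j]) ⋈ b` of a flat `P¹` formula: a list of pairs
of a non-zero integer coefficient and a counting-term-free formula, a comparison
symbol, and a natural-number threshold.  A flat `P¹` formula is a list (i.e. a
finite conjunction) of such conjuncts. -/
structure FlatConjunct (τ : Type) where
  terms : List ({ a : ℤ // a ≠ 0 } × QF τ)
  cmp : Cmp
  bound : ℕ

/-- The value of the counting term `#x[φ]`: the number of elements satisfying `φ`. -/
def countSat {τ M : Type} [Fintype M] (interp : τ → M → Bool) (φ : QF τ) : ℕ :=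
  (Finset.univ.filter (fun a : M => QF.sat interp φ a)).card

/-- Satisfaction of one flat conjunct in a finite structure. -/
def FlatConjunct.sat {τ M : Type} [Fintype M] (interp : τ → M → Bool)
    (c : FlatConjunct τ) : Prop :=
  c.cmp.holds ((c.terms.map (fun p => p.1.1 * (countSat interp p.2 : ℤ))).sum) c.bound

/-- A flat `P¹` formula (a conjunction of flat conjuncts) has a finite model if
it holds in some finite nonempty `τ`-structure. -/
def FlatFinSat {τ : Type} (F : List (FlatConjunct τ)) : Prop :=
  ∃ (M : Type) (instM : Fintype M), Nonempty M ∧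
    ∃ interp : τ → M → Bool, ∀ c ∈ F, @FlatConjunct.sat τ M instM interp c

/-- All conjuncts of a flat formula hold in the structure. -/
def FlatHolds {τ M : Type} [Fintype M] (interp : τ → M → Bool) (F : List (FlatConjunct τ)) : Prop :=
  ∀ c ∈ F, c.sat interp

/-- Value of a flat sum of counting terms. -/
def flatVal {τ M : Type} [Fintype M] (interp : τ → M → Bool)
    (ts : List ({ a : ℤ // a ≠ 0 } × QF τ)) : ℤ :=
  (ts.map (fun p => p.1.1 * (countSat interp p.2 : ℤ))).sum

/-- `L` is an exhaustive case distinction by flat formulas, such that in each case `φ` is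
equivalent to a given counting-free formula. -/
def FormCases {τ : Type} (φ : PFormula τ) (L : List (List (FlatConjunct τ) × QF τ)) : Prop :=
  ∀ (M : Type) [Fintype M] (interp : τ → M → Bool),
    (∃ p ∈ L, FlatHolds interp p.1) ∧
    ∀ p ∈ L, FlatHolds interp p.1 → ∀ x, φ.sat interp x = p.2.sat interp x

/-- The same for terms. -/
def TermCases {τ : Type} (t : PTerm τ)
    (L : List (List (FlatConjunct τ) × List ({ a : ℤ // a ≠ 0 } × QF τ))) : Prop :=
  ∀ (M : Type) [Fintype M] (interp : τ → M → Bool),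
    (∃ p ∈ L, FlatHolds interp p.1) ∧
    ∀ p ∈ L, FlatHolds interp p.1 → t.val interp = flatVal interp p.2

theorem flatHolds_append {τ M : Type} [Fintype M] (interp : τ → M → Bool)
    (F G : List (FlatConjunct τ)) :
    FlatHolds interp (F ++ G) ↔ FlatHolds interp F ∧ FlatHolds interp G := by
  simp [FlatHolds, or_imp, forall_and]

theorem flatHolds_cons {τ M : Type} [Fintype M] (interp : τ → M → Bool)
    (c : FlatConjunct τ) (G : List (FlatConjunct τ)) :
    FlatHolds interp (c :: G) ↔ c.cmp.holds (flatVal interp c.terms) c.bound ∧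
      FlatHolds interp G := by
  simp [FlatHolds, FlatConjunct.sat, flatVal]

/-- A counting-free formula that is always true (or always false). -/
def QF.const {τ : Type} (P : τ) : Bool → QF τ
  | false => .and (.atom P) (.not (.atom P))
  | true => .not (.and (.atom P) (.not (.atom P)))

theorem QF.const_sat {τ M : Type} (interp : τ → M → Bool) (P : τ) (b : Bool) (x : M) :
    (QF.const P b).sat interp x = b := by
  cases b <;> simp [QF.const, QF.sat]

/-- Negation of all coefficients. -/
def negTerms {τ : Type} (ts : List ({ a : ℤ // a ≠ 0 } × QF τ)) :
    List ({ a : ℤ // a ≠ 0 } × QF τ) :=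
  ts.map (fun p => (⟨-p.1.1, neg_ne_zero.mpr p.1.2⟩, p.2))

theorem flatVal_neg {τ M : Type} [Fintype M] (interp : τ → M → Bool)
    (ts : List ({ a : ℤ // a ≠ 0 } × QF τ)) :
    flatVal interp (negTerms ts) = - flatVal interp ts := by
  induction ts with
  | nil => simp [flatVal, negTerms]
  | cons p ts ih =>
    simp only [flatVal, negTerms, List.map_cons, List.sum_cons] at ih ⊢
    rw [ih]; ring

/-- A flat conjunct expressing `ts < b`. -/
def ltConj {τ : Type} (ts : List ({ a : ℤ // a ≠ 0 } × QF τ)) : ℕ → FlatConjunct τ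
  | 0 => ⟨negTerms ts, .ge, 1⟩
  | b + 1 => ⟨ts, .le, b⟩

theorem ltConj_holds {τ M : Type} [Fintype M] (interp : τ → M → Bool)
    (ts : List ({ a : ℤ // a ≠ 0 } × QF τ)) (b : ℕ) :
    (ltConj ts b).cmp.holds (flatVal interp (ltConj ts b).terms) (ltConj ts b).bound ↔
      flatVal interp ts < (b : ℤ) := by
  cases b with
  | zero => simp only [ltConj, Cmp.holds, flatVal_neg]; push_cast; omega
  | succ b => simp only [ltConj, Cmp.holds]; push_cast; omega

mutual
theorem PTerm.exists_atom {τ : Type} : PTerm τ → Nonempty τ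
  | .add t₁ _ => t₁.exists_atom
  | .count _ _ φ => φ.exists_atom

theorem PFormula.exists_atom {τ : Type} : PFormula τ → Nonempty τ
  | .atom P => ⟨P⟩
  | .not φ => φ.exists_atom
  | .and φ _ => φ.exists_atom
  | .ge t _ => t.exists_atom
  | .mod t _ _ _ _ => t.exists_atom
end

mutual
theorem PTerm.cases_exist {τ : Type} (P : τ) : ∀ t : PTerm τ, ∃ L, TermCases t L
  | .add t₁ t₂ => by
    obtain ⟨L₁, h₁⟩ := PTerm.cases_exist P t₁
    obtain ⟨L₂, h₂⟩ := PTerm.cases_exist P t₂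
    refine ⟨(L₁ ×ˢ L₂).map (fun p => (p.1.1 ++ p.2.1, p.1.2 ++ p.2.2)), ?_⟩
    intro M _ interp
    obtain ⟨⟨p₁, m₁, f₁⟩, e₁⟩ := h₁ M interp
    obtain ⟨⟨p₂, m₂, f₂⟩, e₂⟩ := h₂ M interp
    constructor
    · exact ⟨_, List.mem_map_of_mem (List.mem_product.mpr ⟨m₁, m₂⟩ : (p₁, p₂) ∈ L₁ ×ˢ L₂),
        (flatHolds_append _ _ _).mpr ⟨f₁, f₂⟩⟩
    · intro p hp hF
      obtain ⟨⟨q₁, q₂⟩, hq, rfl⟩ := List.mem_map.mp hp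
      obtain ⟨n₁, n₂⟩ := List.mem_product.mp hq
      obtain ⟨g₁, g₂⟩ := (flatHolds_append _ _ _).mp hF
      simp [PTerm.val, e₁ _ n₁ g₁, e₂ _ n₂ g₂, flatVal]
  | .count a ha φ => by
    obtain ⟨L, h⟩ := PFormula.cases_exist P φ
    refine ⟨L.map (fun p => (p.1, [(⟨a, ha⟩, p.2)])), ?_⟩
    intro M _ interp
    obtain ⟨⟨p, m, f⟩, e⟩ := h M interp
    constructor
    · exact ⟨_, List.mem_map_of_mem m, f⟩
    · intro p hp hF
      obtain ⟨q, hq, rfl⟩ := List.mem_map.mp hp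
      simp [PTerm.val, flatVal, countSat, e q hq hF]

theorem PFormula.cases_exist {τ : Type} (P : τ) : ∀ φ : PFormula τ, ∃ L, FormCases φ L
  | .atom Q => ⟨[([], .atom Q)], by
      intro M _ interp
      simp [FlatHolds, PFormula.sat, QF.sat]⟩
  | .not φ => by
    obtain ⟨L, h⟩ := PFormula.cases_exist P φ
    refine ⟨L.map (fun p => (p.1, .not p.2)), ?_⟩
    intro M _ interp
    obtain ⟨⟨p, m, f⟩, e⟩ := h M interp
    constructor
    · exact ⟨_, List.mem_map_of_mem m, f⟩
    · intro p hp hF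
      obtain ⟨q, hq, rfl⟩ := List.mem_map.mp hp
      simp [PFormula.sat, QF.sat, e q hq hF]
  | .and φ₁ φ₂ => by
    obtain ⟨L₁, h₁⟩ := PFormula.cases_exist P φ₁
    obtain ⟨L₂, h₂⟩ := PFormula.cases_exist P φ₂
    refine ⟨(L₁ ×ˢ L₂).map (fun p => (p.1.1 ++ p.2.1, .and p.1.2 p.2.2)), ?_⟩
    intro M _ interp
    obtain ⟨⟨p₁, m₁, f₁⟩, e₁⟩ := h₁ M interp
    obtain ⟨⟨p₂, m₂, f₂⟩, e₂⟩ := h₂ M interp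
    constructor
    · exact ⟨_, List.mem_map_of_mem (List.mem_product.mpr ⟨m₁, m₂⟩ : (p₁, p₂) ∈ L₁ ×ˢ L₂),
        (flatHolds_append _ _ _).mpr ⟨f₁, f₂⟩⟩
    · intro p hp hF
      obtain ⟨⟨q₁, q₂⟩, hq, rfl⟩ := List.mem_map.mp hp
      obtain ⟨n₁, n₂⟩ := List.mem_product.mp hq
      obtain ⟨g₁, g₂⟩ := (flatHolds_append _ _ _).mp hF
      simp [PFormula.sat, QF.sat, e₁ _ n₁ g₁, e₂ _ n₂ g₂]
  | .ge t b => by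
    obtain ⟨L, h⟩ := PTerm.cases_exist P t
    refine ⟨L.map (fun p => (⟨p.2, .ge, b⟩ :: p.1, QF.const P true)) ++
      L.map (fun p => (ltConj p.2 b :: p.1, QF.const P false)), ?_⟩
    intro M _ interp
    obtain ⟨⟨p, m, f⟩, e⟩ := h M interp
    constructor
    · rcases le_or_gt (b : ℤ) (flatVal interp p.2) with hb | hb
      · exact ⟨_, List.mem_append_left _ (List.mem_map_of_mem m),
          (flatHolds_cons _ _ _).mpr ⟨hb, f⟩⟩
      · exact ⟨_, List.mem_append_right _ (List.mem_map_of_mem m),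
          (flatHolds_cons _ _ _).mpr ⟨(ltConj_holds _ _ _).mpr hb, f⟩⟩
    · intro p hp hF x
      rcases List.mem_append.mp hp with hp | hp
      · obtain ⟨q, hq, rfl⟩ := List.mem_map.mp hp
        obtain ⟨g₁, g₂⟩ := (flatHolds_cons _ _ _).mp hF
        have g₃ : (b : ℤ) ≤ flatVal interp q.2 := g₁
        simp [PFormula.sat, QF.const_sat, e q hq g₂, g₃]
      · obtain ⟨q, hq, rfl⟩ := List.mem_map.mp hp
        obtain ⟨g₁, g₂⟩ := (flatHolds_cons _ _ _).mp hF
        have g₃ := (ltConj_holds _ _ _).mp g₁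
        simp [PFormula.sat, QF.const_sat, e q hq g₂, g₃]
  | .mod t c hc d hd => by
    obtain ⟨L, h⟩ := PTerm.cases_exist P t
    refine ⟨(L ×ˢ List.range c).map
      (fun p => (⟨p.1.2, .mod c hc, p.2⟩ :: p.1.1, QF.const P (decide (p.2 = d)))), ?_⟩
    intro M _ interp
    obtain ⟨⟨p, m, f⟩, e⟩ := h M interp
    have hc' : (0 : ℤ) < c := by exact_mod_cast hc
    constructor
    · have h0 := Int.emod_nonneg (flatVal interp p.2) hc'.ne'
      have h1 := Int.emod_lt_of_pos (flatVal interp p.2) hc'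
      obtain ⟨r, hr⟩ := Int.eq_ofNat_of_zero_le h0
      have hrc : r < c := by rw [hr] at h1; exact_mod_cast h1
      refine ⟨_, List.mem_map_of_mem (List.mem_product.mpr ⟨m, List.mem_range.mpr hrc⟩ :
        (p, r) ∈ L ×ˢ List.range c), (flatHolds_cons _ _ _).mpr ⟨?_, f⟩⟩
      change flatVal interp p.2 % (c : ℤ) = (r : ℤ) % (c : ℤ)
      rw [← hr, Int.emod_emod_of_dvd _ (dvd_refl _)]
    · intro p hp hF x
      obtain ⟨⟨q, r⟩, hq, rfl⟩ := List.mem_map.mp hp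
      obtain ⟨n₁, n₂⟩ := List.mem_product.mp hq
      have hrc : r < c := List.mem_range.mp n₂
      obtain ⟨g₁, g₂⟩ := (flatHolds_cons _ _ _).mp hF
      have g₃ : flatVal interp q.2 % (c : ℤ) = (r : ℤ) % (c : ℤ) := g₁
      rw [Int.emod_eq_of_lt (a := (r : ℤ)) (by positivity) (by exact_mod_cast hrc)] at g₃
      simp [PFormula.sat, QF.const_sat, e q n₁ g₂, g₃]
end

/-- Uniform flattening: the disjunction of `S` is equivalent to `∃ x, φ` in every finite
structure. -/
theorem flattening_uniform {τ : Type} (φ : PFormula τ) :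
    ∃ S : List (List (FlatConjunct τ)),
      ∀ (M : Type) [Fintype M] (interp : τ → M → Bool),
        (∃ x, φ.sat interp x = true) ↔ ∃ F ∈ S, FlatHolds interp F := by
  obtain ⟨P⟩ := φ.exists_atom
  obtain ⟨L, h⟩ := PFormula.cases_exist P φ
  refine ⟨L.map (fun p => ⟨[(⟨1, one_ne_zero⟩, p.2)], .ge, 1⟩ :: p.1), ?_⟩
  intro M _ interp
  obtain ⟨⟨p, m, f⟩, e⟩ := h M interp
  have key : ∀ q : QF τ, Cmp.ge.holds (flatVal interp [(⟨1, one_ne_zero⟩, q)]) 1 ↔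
      ∃ x, q.sat interp x = true := by
    intro q
    simp only [Cmp.holds, flatVal, countSat, List.map_cons, List.map_nil, List.sum_cons,
      List.sum_nil, one_mul, add_zero, Nat.cast_le, Nat.one_le_iff_ne_zero, ne_eq,
      Finset.card_eq_zero, Finset.filter_eq_empty_iff]
    simp
  constructor
  · rintro ⟨x, hx⟩
    exact ⟨_, List.mem_map_of_mem m,
      (flatHolds_cons _ _ _).mpr ⟨(key _).mpr ⟨x, by rw [← e p m f]; exact hx⟩, f⟩⟩
  · rintro ⟨F, hF, hh⟩
    obtain ⟨q, hq, rfl⟩ := List.mem_map.mp hF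
    obtain ⟨g₁, g₂⟩ := (flatHolds_cons _ _ _).mp hh
    obtain ⟨x, hx⟩ := (key _).mp g₁
    exact ⟨x, by rw [e q hq g₂]; exact hx⟩

/-- **Flattening.**  For every formula `φ` of the one-variable Presburger logic
`P¹` over `τ` there is a finite set `S` of flat `P¹` formulas over the same
signature `τ` such that `φ` has a finite model iff some member of `S` has a
finite model. -/
theorem flattening {τ : Type} (φ : PFormula τ) :
    ∃ S : List (List (FlatConjunct τ)),
      (PFinSat φ ↔ ∃ F ∈ S, FlatFinSat F) := by
  obtain ⟨S, h⟩ := flattening_uniform φ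
  refine ⟨S, ?_, ?_⟩
  · rintro ⟨M, instM, hM, interp, a, ha⟩
    obtain ⟨F, hF, hh⟩ := (h M interp).mp ⟨a, ha⟩
    exact ⟨F, hF, M, instM, hM, interp, hh⟩
  · rintro ⟨F, hF, M, instM, hM, interp, hh⟩
    obtain ⟨a, ha⟩ := (h M interp).mpr ⟨F, hF, hh⟩
    exact ⟨M, instM, hM, interp, a, ha⟩
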